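/- Let N ≥ 2, let t be a real number with 0 ≤ t < N, and let α > 0. For a measurable function u : ℝ^N → ℝ define v(x) := ((N-t)/N)^{(N-1)/N} · u(|x|^{t/(N-t)} x). Then ∫_{ℝ^N} e^{α|u(y)|^{N/(N-1)}} |u(y)|^N |y|^{-t} dy = (N/(N-t))^N ∫_{ℝ^N} e^{(N/(N-t)) α |v(x)|^{N/(N-1)}} |v(x)|^N dx, where both sides are interpreted as values in [0, ∞]. -/

import Mathlib

open MeasureTheory Real

section RadialPower

variable {E : Type*} [NormedAddCommGroup E] [InnerProductSpace ℝ E]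

theorem norm_rpow_smul_self (s : ℝ) {x : E} (hx : x ≠ 0) :
    ‖‖x‖ ^ s • x‖ = ‖x‖ ^ (1 + s) := by
  have h : 0 < ‖x‖ := norm_pos_iff.2 hx
  rw [norm_smul, Real.norm_of_nonneg (by positivity), Real.rpow_add h, Real.rpow_one, mul_comm]

theorem norm_rpow_smul_norm_rpow_smul (s r : ℝ) {x : E} (hx : x ≠ 0) :
    ‖‖x‖ ^ s • x‖ ^ r • (‖x‖ ^ s • x) = ‖x‖ ^ ((1 + s) * r + s) • x := by
  have h : 0 < ‖x‖ := norm_pos_iff.2 hx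
  rw [norm_rpow_smul_self s hx, smul_smul, ← Real.rpow_mul h.le, ← Real.rpow_add h]

theorem injOn_norm_rpow_smul {s : ℝ} (hs : 1 + s ≠ 0) :
    Set.InjOn (fun x : E ↦ ‖x‖ ^ s • x) {0}ᶜ := by
  refine Set.LeftInvOn.injOn (f₁' := fun y : E ↦ ‖y‖ ^ (-s / (1 + s)) • y) fun x hx ↦ ?_
  have e : (1 + s) * (-s / (1 + s)) + s = 0 := by field_simp; ring
  simp only [norm_rpow_smul_norm_rpow_smul s _ hx, e, Real.rpow_zero, one_smul]

theorem image_norm_rpow_smul_compl_zero {s : ℝ} (hs : 1 + s ≠ 0) :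
    (fun x : E ↦ ‖x‖ ^ s • x) '' {0}ᶜ = {0}ᶜ := by
  have key (r : ℝ) {x : E} (hx : x ≠ 0) : ‖x‖ ^ r • x ≠ 0 :=
    smul_ne_zero (Real.rpow_pos_of_pos (norm_pos_iff.2 hx) r).ne' hx
  refine Set.Subset.antisymm (Set.image_subset_iff.2 fun x hx ↦ key s hx) fun y hy ↦
    ⟨‖y‖ ^ (-s / (1 + s)) • y, key _ hy, ?_⟩
  have e : (1 + -s / (1 + s)) * s + -s / (1 + s) = 0 := by field_simp; ring
  simp only [norm_rpow_smul_norm_rpow_smul _ s hy, e, Real.rpow_zero, one_smul]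

theorem hasFDerivAt_norm_rpow_smul (s : ℝ) {x : E} (hx : x ≠ 0) :
    HasFDerivAt (fun x : E ↦ ‖x‖ ^ s • x)
      (‖x‖ ^ s • (ContinuousLinearMap.id ℝ E + ((s / ‖x‖ ^ 2) • innerSL ℝ x).smulRight x)) x := by
  have h : 0 < ‖x‖ := norm_pos_iff.2 hx
  have h1 := ((hasStrictFDerivAt_norm_sq x).hasFDerivAt.rpow_const (p := s / 2)
    (Or.inl (by positivity))).smul (hasFDerivAt_id x)
  have e (y : E) : (‖y‖ ^ 2) ^ (s / 2) = ‖y‖ ^ s := by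
    rw [← Real.rpow_natCast, ← Real.rpow_mul (norm_nonneg y), Nat.cast_ofNat,
      mul_div_cancel₀ _ two_ne_zero]
  have e2 : (‖x‖ ^ 2) ^ (s / 2 - 1) = ‖x‖ ^ s / ‖x‖ ^ 2 := by
    rw [Real.rpow_sub (by positivity), e, Real.rpow_one]
  refine (h1.congr_of_eventuallyEq (.of_forall fun y ↦ ?_)).congr_fderiv ?_
  · simp [e]
  · ext1 y
    simp only [id, e, e2, smul_apply, add_apply, ContinuousLinearMap.smulRight_apply,
      ContinuousLinearMap.id_apply, smul_add, smul_smul, innerSL_apply_apply, smul_eq_mul,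
      nsmul_eq_mul, Nat.cast_ofNat]
    congr 2
    ring

theorem det_norm_rpow_smul_id_add [FiniteDimensional ℝ E] (s : ℝ) {x : E} (hx : x ≠ 0) :
    (‖x‖ ^ s • (ContinuousLinearMap.id ℝ E +
      ((s / ‖x‖ ^ 2) • innerSL ℝ x).smulRight x)).det =
      (‖x‖ ^ s) ^ Module.finrank ℝ E * (1 + s) := by
  have h : ‖x‖ ≠ 0 := norm_ne_zero_iff.2 hx
  have e : ((‖x‖ ^ s • (ContinuousLinearMap.id ℝ E +
      ((s / ‖x‖ ^ 2) • innerSL ℝ x).smulRight x) : E →L[ℝ] E) : E →ₗ[ℝ] E) =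
      ‖x‖ ^ s • LinearMap.transvection
        (((s / ‖x‖ ^ 2) • innerSL ℝ x : E →L[ℝ] ℝ) : E →ₗ[ℝ] ℝ) x := by
    ext y
    simp [LinearMap.transvection]
  rw [ContinuousLinearMap.det, e, LinearMap.det_smul, LinearMap.transvection.det]
  congr 2
  simp [h]

theorem lintegral_norm_rpow_smul [FiniteDimensional ℝ E] [Nontrivial E] [MeasurableSpace E]
    [BorelSpace E] (μ : Measure E) [μ.IsAddHaarMeasure] {s : ℝ} (hs : 0 < 1 + s)
    (g : E → ENNReal) :
    ∫⁻ y, g y ∂μ = ∫⁻ x, ENNReal.ofReal ((‖x‖ ^ s) ^ Module.finrank ℝ E * (1 + s)) *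
      g (‖x‖ ^ s • x) ∂μ := by
  have h := lintegral_image_eq_lintegral_abs_det_fderiv_mul μ
    (measurableSet_singleton (0 : E)).compl
    (fun x hx ↦ (hasFDerivAt_norm_rpow_smul s hx).hasFDerivWithinAt)
    (injOn_norm_rpow_smul hs.ne') g
  rw [image_norm_rpow_smul_compl_zero hs.ne', restrict_compl_singleton] at h
  rw [h, ← lintegral_congr_ae]
  filter_upwards [compl_mem_ae_iff.2 (measure_singleton (0 : E))] with x hx
  rw [det_norm_rpow_smul_id_add s hx, abs_of_nonneg (by positivity)]

end RadialPower

theorem change_of_variables_exp (N : ℕ) (hN : 2 ≤ N) (t : ℝ) (ht0 : 0 ≤ t)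
    (htN : t < (N : ℝ)) (α : ℝ) (hα : 0 < α)
    (u : EuclideanSpace ℝ (Fin N) → ℝ) (hu : Measurable u)
    (v : EuclideanSpace ℝ (Fin N) → ℝ)
    (hv : ∀ x, v x = (((N : ℝ) - t) / N) ^ (((N : ℝ) - 1) / N) *
      u (‖x‖ ^ (t / ((N : ℝ) - t)) • x)) :
    (∫⁻ y, ENNReal.ofReal
        (Real.exp (α * |u y| ^ ((N : ℝ) / ((N : ℝ) - 1))) * |u y| ^ (N : ℝ) * ‖y‖ ^ (-t)))
      = ENNReal.ofReal (((N : ℝ) / ((N : ℝ) - t)) ^ (N : ℝ)) *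
        ∫⁻ x, ENNReal.ofReal
          (Real.exp (((N : ℝ) / ((N : ℝ) - t)) * α * |v x| ^ ((N : ℝ) / ((N : ℝ) - 1))) *
            |v x| ^ (N : ℝ)) := by
  have : Nonempty (Fin N) := ⟨⟨0, by omega⟩⟩
  have hN' : (2 : ℝ) ≤ N := by exact_mod_cast hN
  have hN0 : (0 : ℝ) < N := by linarith
  have hN1 : (N : ℝ) - 1 ≠ 0 := by linarith
  have hd : 0 < (N : ℝ) - t := by linarith
  have hs : 1 + t / ((N : ℝ) - t) = N / (N - t) := by field_simp; ring
  rw [lintegral_norm_rpow_smul volume (s := t / ((N : ℝ) - t)) (hs ▸ by positivity),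
    ← lintegral_const_mul' _ _ ENNReal.ofReal_ne_top]
  refine lintegral_congr_ae ?_
  filter_upwards [compl_mem_ae_iff.2 (measure_singleton (0 : EuclideanSpace ℝ (Fin N)))] with x hx
  have hx0 : 0 < ‖x‖ := norm_pos_iff.2 hx
  rw [hv, norm_rpow_smul_self _ hx, hs, finrank_euclideanSpace_fin]
  set w := |u (‖x‖ ^ (t / ((N : ℝ) - t)) • x)|
  have hw : 0 ≤ w := abs_nonneg _
  set c := ((N : ℝ) - t) / N with hc
  have hc0 : 0 < c := by positivity
  have hinv : (N : ℝ) / (N - t) = c⁻¹ := by rw [hc, inv_div]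
  rw [abs_mul, abs_of_nonneg (by positivity : 0 ≤ c ^ (((N : ℝ) - 1) / N)),
    Real.mul_rpow (by positivity) hw, Real.mul_rpow (by positivity) hw,
    ← Real.rpow_mul hc0.le, ← Real.rpow_mul hc0.le,
    show ((N : ℝ) - 1) / N * (N / (N - 1)) = 1 by field_simp,
    show ((N : ℝ) - 1) / N * N = N - 1 by field_simp,
    ← ENNReal.ofReal_mul (by positivity), ← ENNReal.ofReal_mul (by positivity), Real.rpow_one]
  congr 1
  have hpow : (‖x‖ ^ (t / ((N : ℝ) - t))) ^ N * (‖x‖ ^ ((N : ℝ) / (N - t))) ^ (-t) = 1 := by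
    rw [← Real.rpow_natCast, ← Real.rpow_mul hx0.le, ← Real.rpow_mul hx0.le, ← Real.rpow_add hx0,
      show t / ((N : ℝ) - t) * N + N / (N - t) * -t = 0 by ring, Real.rpow_zero]
  have hexp : c⁻¹ * α * (c * w ^ ((N : ℝ) / (N - 1))) = α * w ^ ((N : ℝ) / (N - 1)) := by
    field_simp
  have hcN : c⁻¹ ^ (N : ℝ) * c ^ ((N : ℝ) - 1) = c⁻¹ := by
    rw [Real.inv_rpow hc0.le, Real.rpow_sub hc0, Real.rpow_one]
    have := (Real.rpow_pos_of_pos hc0 N).ne'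
    field_simp
  rw [hinv] at hpow ⊢
  rw [hexp]
  linear_combination (c⁻¹ * Real.exp (α * w ^ ((N : ℝ) / (N - 1))) * w ^ (N : ℝ)) * hpow -
    (Real.exp (α * w ^ ((N : ℝ) / (N - 1))) * w ^ (N : ℝ)) * hcN
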